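/- Let G be a Garside group of finite type, x ∈ G, z ∈ SC(x), y = 𝔰(z), and let s ∈ G be positive such that y^s ∈ SSS(x). Then the pullback of s at y is given by s_{(1)} = (𝔭(z) · s · 𝔭↰(y^s)⁻¹) ∨ 1. -/

import Mathlib

/-- A Garside structure of finite type on a group `G`: a submonoid `P` of positive
elements with `P ∩ P⁻¹ = {1}`, such that the prefix order `a ⪯ b ↔ a⁻¹ * b ∈ P` is a
lattice order (with meet `wedge` and join `vee`), together with a Garside element `Δ ∈ P`
whose set of prefixes (the simple elements) is finite and generates `G`, satisfying
`Δ⁻¹ P Δ = P`, and such that every nontrivial positive element has a finite norm. -/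
structure GarsideStructure (G : Type*) [Group G] where
  P : Set G
  one_mem : (1 : G) ∈ P
  mul_mem : ∀ {a b : G}, a ∈ P → b ∈ P → a * b ∈ P
  eq_one_of_mem_of_inv_mem : ∀ a : G, a ∈ P → a⁻¹ ∈ P → a = 1
  wedge : G → G → G
  vee : G → G → G
  wedge_le_left : ∀ a b : G, (wedge a b)⁻¹ * a ∈ P
  wedge_le_right : ∀ a b : G, (wedge a b)⁻¹ * b ∈ P
  le_wedge : ∀ a b c : G, c⁻¹ * a ∈ P → c⁻¹ * b ∈ P → c⁻¹ * wedge a b ∈ P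
  le_vee_left : ∀ a b : G, a⁻¹ * vee a b ∈ P
  le_vee_right : ∀ a b : G, b⁻¹ * vee a b ∈ P
  vee_le : ∀ a b c : G, a⁻¹ * c ∈ P → b⁻¹ * c ∈ P → (vee a b)⁻¹ * c ∈ P
  Δ : G
  Δ_mem : Δ ∈ P
  simples_finite : {s : G | s ∈ P ∧ s⁻¹ * Δ ∈ P}.Finite
  simples_generate : Subgroup.closure {s : G | s ∈ P ∧ s⁻¹ * Δ ∈ P} = (⊤ : Subgroup G)
  conj_Delta_mem : ∀ a : G, a ∈ P → Δ⁻¹ * a * Δ ∈ P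
  mem_of_conj_Delta_mem : ∀ a : G, Δ⁻¹ * a * Δ ∈ P → a ∈ P
  norm_bounded : ∀ x : G, x ∈ P → x ≠ 1 →
    ∃ n : ℕ, ∀ L : List G, (∀ a ∈ L, a ∈ P ∧ a ≠ 1) → L.prod = x → L.length ≤ n

namespace GarsideStructure

variable {G : Type*} [Group G] (gs : GarsideStructure G)

/-- The prefix order: `a ⪯ b`. -/
def pre (a b : G) : Prop := a⁻¹ * b ∈ gs.P

/-- The suffix order: `a ≽ b` (i.e. `b` is a suffix of `a`). -/
def rdvd (a b : G) : Prop := a * b⁻¹ ∈ gs.P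

/-- Greatest common divisor with respect to the suffix order `≽` : `a ∧↰ b`. -/
def rwedge (a b : G) : G := (gs.vee a⁻¹ b⁻¹)⁻¹

/-- Least common multiple with respect to the suffix order `≽` : `a ∨↰ b`. -/
def rvee (a b : G) : G := (gs.wedge a⁻¹ b⁻¹)⁻¹

/-- Simple elements: positive prefixes of `Δ`. -/
def simple (s : G) : Prop := s ∈ gs.P ∧ s⁻¹ * gs.Δ ∈ gs.P

/-- Atoms: nontrivial positive elements which cannot be decomposed in `P`. -/
def atom (a : G) : Prop := a ∈ gs.P ∧ a ≠ 1 ∧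
  ∀ b c : G, b ∈ gs.P → c ∈ gs.P → a = b * c → b = 1 ∨ c = 1

/-- `inf x` : the maximal integer `p` with `Δ^p ⪯ x`. -/
noncomputable def ginf (x : G) : ℤ := sSup {p : ℤ | gs.pre (gs.Δ ^ p) x}

/-- `sup x` : the minimal integer `p` with `x ⪯ Δ^p`. -/
noncomputable def gsup (x : G) : ℤ := sInf {p : ℤ | gs.pre x (gs.Δ ^ p)}

/-- Canonical length `ℓ(x) = sup(x) - inf(x)`. -/
noncomputable def glen (x : G) : ℤ := gs.gsup x - gs.ginf x

/-- `‖x‖` : the maximal number of factors in a decomposition of `x` as a product of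
nontrivial positive elements. -/
noncomputable def gnorm (x : G) : ℕ :=
  sSup {k : ℕ | ∃ L : List G, (∀ a ∈ L, a ∈ gs.P ∧ a ≠ 1) ∧ L.prod = x ∧ L.length = k}

/-- The summit infimum `inf_s(x)` : the maximum of `inf` over the conjugacy class of `x`. -/
noncomputable def ginfs (x : G) : ℤ :=
  sSup {p : ℤ | ∃ y : G, (∃ α : G, α⁻¹ * x * α = y) ∧ p = gs.ginf y}

/-- The summit supremum `sup_s(x)` : the minimum of `sup` over the conjugacy class of `x`. -/
noncomputable def gsups (x : G) : ℤ :=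
  sInf {p : ℤ | ∃ y : G, (∃ α : G, α⁻¹ * x * α = y) ∧ p = gs.gsup y}

/-- The preferred prefix `𝔭(x) = (xΔ^{-inf x}) ∧ (x⁻¹Δ^{sup x}) ∧ Δ`. -/
noncomputable def pp (x : G) : G :=
  gs.wedge (gs.wedge (x * gs.Δ ^ (-gs.ginf x)) (x⁻¹ * gs.Δ ^ gs.gsup x)) gs.Δ

/-- Cyclic (left) sliding `𝔰(x) = 𝔭(x)⁻¹ x 𝔭(x)`. -/
noncomputable def sl (x : G) : G := (gs.pp x)⁻¹ * x * gs.pp x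

/-- The preferred suffix `𝔭↰(x) = (Δ^{-inf x}x) ∧↰ (Δ^{sup x}x⁻¹) ∧↰ Δ`. -/
noncomputable def ps (x : G) : G :=
  gs.rwedge (gs.rwedge (gs.Δ ^ (-gs.ginf x) * x) (gs.Δ ^ gs.gsup x * x⁻¹)) gs.Δ

/-- Cyclic right sliding `𝔰↰(x) = 𝔭↰(x) x 𝔭↰(x)⁻¹`. -/
noncomputable def rsl (x : G) : G := gs.ps x * x * (gs.ps x)⁻¹

/-- The super summit set `SSS(x)` : conjugates of `x` with maximal infimum and minimal
supremum among all conjugates of `x`. -/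
def SSS (x : G) : Set G :=
  {y | (∃ α : G, α⁻¹ * x * α = y) ∧
    ∀ z : G, (∃ α : G, α⁻¹ * x * α = z) → gs.ginf z ≤ gs.ginf y ∧ gs.gsup y ≤ gs.gsup z}

/-- The set of sliding circuits `SC(x)` : conjugates `y` of `x` with `𝔰^m(y) = y` for
some `m ≥ 1`. -/
noncomputable def SC (x : G) : Set G :=
  {y | (∃ α : G, α⁻¹ * x * α = y) ∧ ∃ m : ℕ, 1 ≤ m ∧ (gs.sl)^[m] y = y}

/-- The transport `α^{(1)} = 𝔭(x)⁻¹ α 𝔭(x^α)` of `α` at `x`. -/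
noncomputable def transport (x α : G) : G := (gs.pp x)⁻¹ * α * gs.pp (α⁻¹ * x * α)

/-- Iterated transport `α^{(i)}` of `α` at `x`: `α^{(0)} = α` and `α^{(i+1)}` is the
transport of `α^{(i)}` at `𝔰^i(x)`. -/
noncomputable def transportIter (x α : G) : ℕ → G
  | 0 => α
  | i + 1 => gs.transport ((gs.sl)^[i] x) (transportIter x α i)

/-- `c` is the `⪯`-minimal element `c_s(y)` satisfying `s ⪯ c` and `y^c ∈ SC(x)`. -/
def IsMinSCConj (x y s c : G) : Prop :=
  gs.pre s c ∧ (c⁻¹ * y * c) ∈ gs.SC x ∧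
    ∀ d : G, gs.pre s d → (d⁻¹ * y * d) ∈ gs.SC x → gs.pre c d

/-- `s` is an indecomposable conjugator starting at `u`: `u^s ∈ SC(x)`, `s ≠ 1` and there
is no `t` with `1 ≺ t ≺ s` and `u^t ∈ SC(x)`. -/
def IsIndecomposableConjugator (x u s : G) : Prop :=
  (s⁻¹ * u * s) ∈ gs.SC x ∧ s ≠ 1 ∧
    ¬ ∃ t : G, (gs.pre 1 t ∧ t ≠ 1) ∧ (gs.pre t s ∧ t ≠ s) ∧ (t⁻¹ * u * t) ∈ gs.SC x

/-- `u` is the pullback of `s` at `y = 𝔰(z)` : the `⪯`-minimal positive element with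
`z^u ∈ SSS(x)` and `s ⪯ u^{(1)}` (transport at `z`). -/
def IsPullback (x z s u : G) : Prop :=
  u ∈ gs.P ∧ (u⁻¹ * z * u) ∈ gs.SSS x ∧ gs.pre s (gs.transport z u) ∧
    ∀ u' : G, u' ∈ gs.P → (u'⁻¹ * z * u') ∈ gs.SSS x → gs.pre s (gs.transport z u') →
      gs.pre u u'

/-- The pullback `s_{(1)}` of `s` at `y = 𝔰(z)`. -/
noncomputable def pullbackOne (x z s : G) : G :=
  @Classical.epsilon G ⟨1⟩ (fun u => gs.IsPullback x z s u)

/-- The `k`-fold pullback `s_{(k)}` of `s` at `y = 𝔰^k(z)` (an element at `z`):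
`s_{(0)} = s` and `s_{(k+1)}` is the pullback at `𝔰(z)` (relative to `z`) of the `k`-fold
pullback of `s` at `𝔰^k(𝔰(z)) = y`. -/
noncomputable def pullbackIter (x : G) : G → ℕ → G → G
  | _, 0, s => s
  | z, k + 1, s => gs.pullbackOne x z (pullbackIter x (gs.sl z) k s)

end GarsideStructure

open GarsideStructure

variable {G : Type*} [Group G]

namespace GarsideStructure

variable (gs : GarsideStructure G)

theorem pre_refl (a : G) : gs.pre a a := by
  simpa [pre] using gs.one_mem

variable {gs}

theorem pre.trans {a b c : G} (hab : gs.pre a b) (hbc : gs.pre b c) : gs.pre a c := by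
  have h := gs.mul_mem hab hbc
  rwa [show a⁻¹ * b * (b⁻¹ * c) = a⁻¹ * c by group] at h

theorem pre.antisymm {a b : G} (hab : gs.pre a b) (hba : gs.pre b a) : a = b := by
  have h := gs.eq_one_of_mem_of_inv_mem _ hab (by simpa [pre] using hba)
  exact inv_mul_eq_one.mp h

variable (gs)

/-- The prefix order as a lattice structure. -/
abbrev toLattice : Lattice G where
  le := gs.pre
  le_refl := gs.pre_refl
  le_trans _ _ _ := pre.trans
  le_antisymm _ _ := pre.antisymm
  inf := gs.wedge
  inf_le_left := gs.wedge_le_left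
  inf_le_right := gs.wedge_le_right
  le_inf a b c := gs.le_wedge b c a
  sup := gs.vee
  le_sup_left := gs.le_vee_left
  le_sup_right := gs.le_vee_right
  sup_le := gs.vee_le

theorem conj_zpow_mem (k : ℤ) {a : G} (ha : a ∈ gs.P) : gs.Δ ^ (-k) * a * gs.Δ ^ k ∈ gs.P := by
  induction k using Int.induction_on with
  | zero => simpa using ha
  | succ n ih =>
    convert gs.conj_Delta_mem _ ih using 1
    group
  | pred n ih =>
    refine gs.mem_of_conj_Delta_mem _ ?_
    convert ih using 1
    group

theorem pre_mul_left_iff (c a b : G) : gs.pre (c * a) (c * b) ↔ gs.pre a b := by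
  simp [pre, mul_assoc]

theorem pre_mul_zpow_iff (k : ℤ) (a b : G) :
    gs.pre (a * gs.Δ ^ k) (b * gs.Δ ^ k) ↔ gs.pre a b := by
  have key : ∀ (k : ℤ) {a b : G}, gs.pre a b → gs.pre (a * gs.Δ ^ k) (b * gs.Δ ^ k) := by
    intro k a b h
    unfold pre
    convert gs.conj_zpow_mem k h using 1
    group
  refine ⟨fun h => ?_, key k⟩
  simpa [mul_assoc] using key (-k) h

theorem pre_shift_iff (x : G) (k : ℤ) (a b : G) :
    gs.pre (x * a * gs.Δ ^ k) (x * b * gs.Δ ^ k) ↔ gs.pre a b := by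
  rw [pre_mul_zpow_iff, pre_mul_left_iff]

theorem pre_mul_zpow_left_iff (k : ℤ) (a b : G) :
    gs.pre (a * gs.Δ ^ k) b ↔ gs.pre a (b * gs.Δ ^ (-k)) := by
  rw [← gs.pre_mul_zpow_iff (-k), mul_assoc a, ← zpow_add]
  simp

theorem pre_mul_zpow_right_iff (k : ℤ) (a b : G) :
    gs.pre a (b * gs.Δ ^ k) ↔ gs.pre (a * gs.Δ ^ (-k)) b := by
  rw [pre_mul_zpow_left_iff, neg_neg]

theorem pre_mul_inv_left_iff (x a b : G) : gs.pre (x⁻¹ * a) b ↔ gs.pre a (x * b) := by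
  rw [← gs.pre_mul_left_iff x, mul_inv_cancel_left]

theorem pre_mul_inv_right_iff (x a b : G) : gs.pre a (x⁻¹ * b) ↔ gs.pre (x * a) b := by
  rw [← gs.pre_mul_left_iff x, mul_inv_cancel_left]

theorem one_pre_iff (a : G) : gs.pre 1 a ↔ a ∈ gs.P := by
  simp [pre]

theorem zpow_mem {k : ℤ} (hk : 0 ≤ k) : gs.Δ ^ k ∈ gs.P := by
  lift k to ℕ using hk
  induction k with
  | zero => simpa using gs.one_mem
  | succ n ih =>
    have h := gs.mul_mem ih gs.Δ_mem
    rwa [← zpow_add_one] at h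

theorem zpow_pre_zpow {m n : ℤ} (h : m ≤ n) : gs.pre (gs.Δ ^ m) (gs.Δ ^ n) := by
  have h' := gs.zpow_mem (sub_nonneg.mpr h)
  rwa [sub_eq_neg_add, zpow_add, zpow_neg] at h'

theorem shift_wedge (x : G) (k : ℤ) (a b : G) :
    x * gs.wedge a b * gs.Δ ^ k = gs.wedge (x * a * gs.Δ ^ k) (x * b * gs.Δ ^ k) := by
  apply pre.antisymm
  · exact gs.le_wedge _ _ _ ((gs.pre_shift_iff _ _ _ _).mpr (gs.wedge_le_left a b))
      ((gs.pre_shift_iff _ _ _ _).mpr (gs.wedge_le_right a b))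
  · have h : ∀ c, gs.pre (x * c * gs.Δ ^ k) (x * a * gs.Δ ^ k) →
        gs.pre (x * c * gs.Δ ^ k) (x * b * gs.Δ ^ k) →
        gs.pre (x * c * gs.Δ ^ k) (x * gs.wedge a b * gs.Δ ^ k) := fun c h₁ h₂ =>
      (gs.pre_shift_iff _ _ _ _).mpr (gs.le_wedge _ _ _
        ((gs.pre_shift_iff _ _ _ _).mp h₁) ((gs.pre_shift_iff _ _ _ _).mp h₂))
    specialize h (x⁻¹ * gs.wedge (x * a * gs.Δ ^ k) (x * b * gs.Δ ^ k) * gs.Δ ^ (-k))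
    rw [show ∀ w : G, x * (x⁻¹ * w * gs.Δ ^ (-k)) * gs.Δ ^ k = w by intro w; group] at h
    exact h (gs.wedge_le_left _ _) (gs.wedge_le_right _ _)

theorem pre_vee_of_left {a b c : G} (h : gs.pre c a) : gs.pre c (gs.vee a b) :=
  h.trans (gs.le_vee_left a b)

theorem wedge_pre_of_left {a b c : G} (h : gs.pre a c) : gs.pre (gs.wedge a b) c :=
  pre.trans (gs.wedge_le_left a b) h

theorem exists_zpow_pre_and_pre_zpow (x : G) :
    ∃ m n : ℤ, gs.pre (gs.Δ ^ m) x ∧ gs.pre x (gs.Δ ^ n) := by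
  have hx : x ∈ Subgroup.closure {s : G | s ∈ gs.P ∧ s⁻¹ * gs.Δ ∈ gs.P} := by
    rw [gs.simples_generate]
    trivial
  induction hx using Subgroup.closure_induction with
  | mem s hs => exact ⟨0, 1, by simpa [pre] using hs.1, by simpa [pre] using hs.2⟩
  | one => exact ⟨0, 0, by simpa using gs.pre_refl 1, by simpa using gs.pre_refl 1⟩
  | mul a b _ _ iha ihb =>
    obtain ⟨m, n, hm, hn⟩ := iha
    obtain ⟨m', n', hm', hn'⟩ := ihb
    refine ⟨m + m', n + n', ?_, ?_⟩
    · rw [zpow_add]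
      exact ((gs.pre_mul_zpow_iff _ _ _).mpr hm).trans ((gs.pre_mul_left_iff _ _ _).mpr hm')
    · rw [zpow_add]
      exact ((gs.pre_mul_left_iff _ _ _).mpr hn').trans ((gs.pre_mul_zpow_iff _ _ _).mpr hn)
  | inv a _ ih =>
    obtain ⟨m, n, hm, hn⟩ := ih
    refine ⟨-n, -m, ?_, ?_⟩
    · rw [← mul_one a⁻¹, pre_mul_inv_right_iff, ← pre_mul_zpow_right_iff, one_mul]
      exact hn
    · rw [← mul_one a⁻¹, pre_mul_inv_left_iff, ← pre_mul_zpow_left_iff, one_mul]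
      exact hm

theorem subsingleton_of_Delta_eq_one (h : gs.Δ = 1) : Subsingleton G := by
  have hG := gs.simples_generate
  rw [h] at hG
  have hs : {s : G | s ∈ gs.P ∧ s⁻¹ * 1 ∈ gs.P} ⊆ {1} := fun s hs =>
    gs.eq_one_of_mem_of_inv_mem s hs.1 (by simpa using hs.2)
  have hbot : (⊤ : Subgroup G) = ⊥ := by
    rw [← hG, Subgroup.closure_eq_bot_iff]
    exact hs
  have hone (a : G) : a = 1 := Subgroup.mem_bot.mp (hbot ▸ Subgroup.mem_top a)
  exact ⟨fun a b => (hone a).trans (hone b).symm⟩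

variable {gs}

theorem le_of_zpow_pre_zpow (hΔ : gs.Δ ≠ 1) {m n : ℤ} (h : gs.pre (gs.Δ ^ m) (gs.Δ ^ n)) :
    m ≤ n := by
  by_contra! hlt
  apply hΔ
  refine gs.eq_one_of_mem_of_inv_mem _ gs.Δ_mem ?_
  have h' := gs.mul_mem (gs.zpow_mem (by lia : 0 ≤ m - n - 1)) h
  convert h' using 1
  group

theorem le_ginf_iff (hΔ : gs.Δ ≠ 1) {m : ℤ} {x : G} : m ≤ gs.ginf x ↔ gs.pre (gs.Δ ^ m) x := by
  obtain ⟨a, b, ha, hb⟩ := gs.exists_zpow_pre_and_pre_zpow x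
  have hbdd : BddAbove {p : ℤ | gs.pre (gs.Δ ^ p) x} :=
    ⟨b, fun p hp => le_of_zpow_pre_zpow hΔ (pre.trans hp hb)⟩
  exact ⟨fun h => (gs.zpow_pre_zpow h).trans (Int.csSup_mem ⟨a, ha⟩ hbdd),
    fun h => le_csSup hbdd h⟩

theorem gsup_le_iff (hΔ : gs.Δ ≠ 1) {m : ℤ} {x : G} : gs.gsup x ≤ m ↔ gs.pre x (gs.Δ ^ m) := by
  obtain ⟨a, b, ha, hb⟩ := gs.exists_zpow_pre_and_pre_zpow x
  have hbdd : BddBelow {p : ℤ | gs.pre x (gs.Δ ^ p)} :=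
    ⟨a, fun p hp => le_of_zpow_pre_zpow hΔ (pre.trans ha hp)⟩
  exact ⟨fun h => (Int.csInf_mem ⟨b, hb⟩ hbdd : gs.pre x _).trans (gs.zpow_pre_zpow h),
    fun h => csInf_le hbdd h⟩

variable (gs)

theorem zpow_pre_conj_iff (m : ℤ) (x α : G) :
    gs.pre (gs.Δ ^ m) (α⁻¹ * x * α) ↔ gs.pre (α * gs.Δ ^ m) (x * α) := by
  rw [mul_assoc, pre_mul_inv_right_iff]

theorem conj_pre_zpow_iff (m : ℤ) (x α : G) :
    gs.pre (α⁻¹ * x * α) (gs.Δ ^ m) ↔ gs.pre (x * α) (α * gs.Δ ^ m) := by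
  rw [mul_assoc, pre_mul_inv_left_iff]

/-- The conjugate of `x` by `α` lies between `Δ ^ p` and `Δ ^ q`. -/
def ConjBounded (p q : ℤ) (x α : G) : Prop :=
  gs.pre (α * gs.Δ ^ p) (x * α) ∧ gs.pre (x * α) (α * gs.Δ ^ q)

theorem conjBounded_iff (hΔ : gs.Δ ≠ 1) (p q : ℤ) (x α : G) :
    gs.ConjBounded p q x α ↔ p ≤ gs.ginf (α⁻¹ * x * α) ∧ gs.gsup (α⁻¹ * x * α) ≤ q := by
  rw [le_ginf_iff hΔ, gsup_le_iff hΔ, zpow_pre_conj_iff, conj_pre_zpow_iff, ConjBounded]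

variable {gs}

namespace ConjBounded

variable {p q : ℤ} {x α β : G}

theorem wedge (ha : gs.ConjBounded p q x α) (hb : gs.ConjBounded p q x β) :
    gs.ConjBounded p q x (gs.wedge α β) := by
  have hx := gs.shift_wedge x 0 α β
  have hΔ (k : ℤ) := gs.shift_wedge 1 k α β
  simp only [zpow_zero, mul_one, one_mul] at hx hΔ
  constructor
  · rw [hx]
    exact gs.le_wedge _ _ _
      (pre.trans ((gs.pre_mul_zpow_iff _ _ _).mpr (gs.wedge_le_left α β)) ha.1)
      (pre.trans ((gs.pre_mul_zpow_iff _ _ _).mpr (gs.wedge_le_right α β)) hb.1)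
  · rw [hΔ]
    exact gs.le_wedge _ _ _
      (pre.trans ((gs.pre_mul_left_iff _ _ _).mpr (gs.wedge_le_left α β)) ha.2)
      (pre.trans ((gs.pre_mul_left_iff _ _ _).mpr (gs.wedge_le_right α β)) hb.2)

theorem vee (ha : gs.ConjBounded p q x α) (hb : gs.ConjBounded p q x β) :
    gs.ConjBounded p q x (gs.vee α β) := by
  constructor
  · rw [pre_mul_zpow_left_iff]
    exact gs.vee_le _ _ _
      ((gs.pre_mul_zpow_left_iff _ _ _).mp
        (ha.1.trans ((gs.pre_mul_left_iff _ _ _).mpr (gs.le_vee_left α β))))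
      ((gs.pre_mul_zpow_left_iff _ _ _).mp
        (hb.1.trans ((gs.pre_mul_left_iff _ _ _).mpr (gs.le_vee_right α β))))
  · rw [← pre_mul_inv_right_iff]
    exact gs.vee_le _ _ _
      ((gs.pre_mul_inv_right_iff _ _ _).mpr
        (ha.2.trans ((gs.pre_mul_zpow_iff _ _ _).mpr (gs.le_vee_left α β))))
      ((gs.pre_mul_inv_right_iff _ _ _).mpr
        (hb.2.trans ((gs.pre_mul_zpow_iff _ _ _).mpr (gs.le_vee_right α β))))

theorem mul_zpow (h : gs.ConjBounded p q x α) (k : ℤ) :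
    gs.ConjBounded p q x (α * gs.Δ ^ k) := by
  unfold ConjBounded
  simp only [mul_assoc, ← zpow_add, add_comm k]
  simpa only [zpow_add, ← mul_assoc, pre_mul_zpow_iff, ConjBounded] using h

theorem self_mul (h : gs.ConjBounded p q x α) : gs.ConjBounded p q x (x * α) := by
  unfold ConjBounded
  simp only [mul_assoc, pre_mul_left_iff]
  exact h

theorem inv_mul (h : gs.ConjBounded p q x α) : gs.ConjBounded p q x (x⁻¹ * α) := by
  unfold ConjBounded
  simp only [mul_assoc, pre_mul_inv_left_iff, pre_mul_inv_right_iff, mul_inv_cancel_left]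
  exact h

theorem pp (h : gs.ConjBounded p q x 1) : gs.ConjBounded p q x (gs.pp x) := by
  have h₁ := h.self_mul.mul_zpow (-gs.ginf x)
  have h₂ := h.inv_mul.mul_zpow (gs.gsup x)
  have h₃ := h.mul_zpow 1
  simp only [mul_one, one_mul, zpow_one] at h₁ h₂ h₃
  exact (h₁.wedge h₂).wedge h₃

theorem inv_ps (h : gs.ConjBounded p q x 1) : gs.ConjBounded p q x (gs.ps x)⁻¹ := by
  have h₁ := h.inv_mul.mul_zpow (gs.ginf x)
  have h₂ := h.self_mul.mul_zpow (-gs.gsup x)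
  have h₃ := h.mul_zpow (-1)
  simp only [mul_one, one_mul, zpow_neg_one] at h₁ h₂ h₃
  simpa [GarsideStructure.ps, rwedge] using (h₁.vee h₂).vee h₃

theorem trans {x y α β : G} (h : gs.ConjBounded p q y β) (hy : y = α⁻¹ * x * α) :
    gs.ConjBounded p q x (α * β) := by
  subst hy
  have h₁ : α⁻¹ * x * α * β = α⁻¹ * (x * (α * β)) := by group
  unfold ConjBounded at h
  rw [h₁, pre_mul_inv_right_iff, pre_mul_inv_left_iff] at h
  simpa only [ConjBounded, mul_assoc] using h

end ConjBounded

/-- A descending chain in the prefix order that is bounded below repeats a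
value at some step. -/
theorem exists_succ_eq_of_descending {f : ℕ → G} {b : G} (hf : ∀ n, gs.pre (f (n + 1)) (f n))
    (hb : ∀ n, gs.pre b (f n)) : ∃ n, f (n + 1) = f n := by
  by_contra! hne
  have hne_b (n : ℕ) : b ≠ f n := fun h => hne n ((hf n).antisymm (h ▸ hb (n + 1)))
  have hlist (n : ℕ) : ∃ L : List G, (∀ a ∈ L, a ∈ gs.P ∧ a ≠ 1) ∧ L.prod = (f n)⁻¹ * f 0 ∧
      L.length = n := by
    induction n with
    | zero => exact ⟨[], by simp⟩
    | succ n ih =>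
      obtain ⟨L, hL, hprod, hlen⟩ := ih
      refine ⟨((f (n + 1))⁻¹ * f n) :: L, ?_, ?_, by simp [hlen]⟩
      · simp only [List.forall_mem_cons]
        exact ⟨⟨hf n, fun h => hne n (inv_mul_eq_one.mp h)⟩, hL⟩
      · rw [List.prod_cons, hprod]
        group
  obtain ⟨n, hn⟩ := gs.norm_bounded _ (hb 0) fun h => hne_b 0 (inv_mul_eq_one.mp h)
  obtain ⟨L, hL, hprod, hlen⟩ := hlist n
  have := hn ((b⁻¹ * f n) :: L)
    (List.forall_mem_cons.mpr ⟨⟨hb n, fun h => hne_b n (inv_mul_eq_one.mp h)⟩, hL⟩)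
    (by rw [List.prod_cons, hprod]; group)
  simp [hlen] at this

/-- Let `A`, `C` be commuting inf-preserving maps with `a ≤ A (C a)`. If the iterates of
`a ↦ C a ⊓ a` stabilise at step `n`, then the `n`-th iterate `e` of `a ↦ C a ⊓ A a ⊓ a`
satisfies `e ≤ C e`. -/
theorem iterate_inf_le_of_stable {L : Type*} [SemilatticeInf L] {A C : L → L}
    (hA : ∀ a b, A (a ⊓ b) = A a ⊓ A b) (hC : ∀ a b, C (a ⊓ b) = C a ⊓ C b)
    (hCA : ∀ a, C (A a) = A (C a)) (hAC : ∀ a, a ≤ A (C a)) (t : L) (n : ℕ)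
    (hn : (fun a => C a ⊓ a)^[n + 1] t = (fun a => C a ⊓ a)^[n] t) :
    (fun a => C a ⊓ A a ⊓ a)^[n] t ≤ C ((fun a => C a ⊓ A a ⊓ a)^[n] t) := by
  set K : ℕ → L := fun n => (fun a => C a ⊓ a)^[n] t with hK
  set M : ℕ → L := fun n => (fun a => A a ⊓ a)^[n] t with hM
  have K_succ (n) : K (n + 1) = C (K n) ⊓ K n := Function.iterate_succ_apply' _ _ _
  have M_succ (n) : M (n + 1) = A (M n) ⊓ M n := Function.iterate_succ_apply' _ _ _
  have K_one (n) : K (n + 1) ≤ C t := by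
    induction n with
    | zero => exact (K_succ 0).trans_le inf_le_left
    | succ n ih => exact ((K_succ (n + 1)).trans_le inf_le_right).trans ih
  have M_one (n) : M (n + 1) ≤ A t := by
    induction n with
    | zero => exact (M_succ 0).trans_le inf_le_left
    | succ n ih => exact ((M_succ (n + 1)).trans_le inf_le_right).trans ih
  have CM (n) : C t ⊓ M n ≤ C (M n) := by
    induction n with
    | zero => exact inf_le_left
    | succ n ih =>
      rw [M_succ, hC, hCA]
      exact le_inf ((inf_le_right.trans inf_le_right).trans (hAC _))
        ((inf_le_inf_left _ inf_le_right).trans ih)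
  have AK (n) : A t ⊓ K n ≤ A (K n) := by
    induction n with
    | zero => exact inf_le_left
    | succ n ih =>
      rw [K_succ, hA]
      exact le_inf ((inf_le_right.trans inf_le_right).trans (hAC _))
        ((inf_le_inf_left _ inf_le_right).trans ih)
  have he (n) : (fun a => C a ⊓ A a ⊓ a)^[n] t = K n ⊓ M n := by
    induction n with
    | zero => exact (inf_idem t).symm
    | succ n ih =>
      rw [Function.iterate_succ_apply', ih, hA, hC]
      have h₁ : K (n + 1) ⊓ M (n + 1) ≤ C (M n) :=
        (inf_le_inf (K_one n) ((M_succ n).trans_le inf_le_right)).trans (CM n)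
      have h₂ : K (n + 1) ⊓ M (n + 1) ≤ A (K n) :=
        (inf_comm _ _).trans_le <|
          (inf_le_inf (M_one n) ((K_succ n).trans_le inf_le_right)).trans (AK n)
      have h₃ : K (n + 1) ⊓ M (n + 1) ≤ C (K n) ⊓ K n := inf_le_left.trans (K_succ n).le
      have h₄ : K (n + 1) ⊓ M (n + 1) ≤ A (M n) ⊓ M n := inf_le_right.trans (M_succ n).le
      apply le_antisymm
      · rw [K_succ, M_succ]
        refine le_inf (le_inf ?_ ?_) (le_inf ?_ ?_)
        · exact (inf_le_left.trans inf_le_left).trans inf_le_left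
        · exact inf_le_right.trans inf_le_left
        · exact (inf_le_left.trans inf_le_right).trans inf_le_right
        · exact inf_le_right.trans inf_le_right
      · exact le_inf (le_inf (le_inf (h₃.trans inf_le_left) h₁)
          (le_inf h₂ (h₄.trans inf_le_left)))
          (le_inf (h₃.trans inf_le_right) (h₄.trans inf_le_right))
  have hstable : K (n + 1) = K n := hn
  rw [he, hC]
  refine le_inf ?_ ((inf_le_inf_right _ (hstable ▸ K_one n)).trans (CM n))
  exact inf_le_left.trans (hstable.ge.trans ((K_succ n).trans_le inf_le_left))

variable (gs)

theorem exists_pre_one_and_pre_shift {x α : G} {k : ℤ} (h : gs.pre α (x * α * gs.Δ ^ k)) :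
    ∃ b, gs.pre b 1 ∧ gs.pre b (x * b * gs.Δ ^ k) := by
  obtain ⟨-, n, -, hn⟩ := gs.exists_zpow_pre_and_pre_zpow α
  refine ⟨α * gs.Δ ^ (-n), ?_, ?_⟩
  · rwa [pre_mul_zpow_left_iff, neg_neg, one_mul]
  · rw [← mul_assoc, mul_assoc _ (gs.Δ ^ (-n)), ← zpow_add, add_comm, zpow_add, ← mul_assoc,
      pre_mul_zpow_iff]
    exact h

theorem shift_eq_one {x α : G} {k : ℤ} (h : gs.pre α (x * α * gs.Δ ^ k))
    (hx : gs.pre (x * gs.Δ ^ k) 1) : x * gs.Δ ^ k = 1 := by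
  obtain ⟨b, hb, hbx⟩ := gs.exists_pre_one_and_pre_shift h
  set C : G → G := fun a => x * a * gs.Δ ^ k with hC
  have C_inj : Function.Injective C := fun a b h => by simpa [hC] using h
  have hdesc (n : ℕ) : gs.pre (C^[n + 1] 1) (C^[n] 1) := by
    induction n with
    | zero => simpa [hC] using hx
    | succ n ih =>
      rw [Function.iterate_succ_apply' C (n + 1), Function.iterate_succ_apply' C n] at *
      exact (gs.pre_shift_iff _ _ _ _).mpr ih
  have hbdd (n : ℕ) : gs.pre b (C^[n] 1) := by
    induction n with
    | zero => exact hb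
    | succ n ih =>
      rw [Function.iterate_succ_apply']
      exact hbx.trans ((gs.pre_shift_iff _ _ _ _).mpr ih)
  obtain ⟨n, hn⟩ := exists_succ_eq_of_descending hdesc hbdd
  rw [Function.iterate_succ_apply] at hn
  simpa [hC] using C_inj.iterate n hn

theorem exists_iterate_pre_shift {x α : G} {k l : ℤ} (h : gs.pre α (x * α * gs.Δ ^ k))
    (hkl : 0 ≤ k + l) :
    ∃ n e, (fun a => gs.wedge (gs.wedge (x * a * gs.Δ ^ k) (x⁻¹ * a * gs.Δ ^ l)) a)^[n] 1 = e ∧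
      gs.pre e (x * e * gs.Δ ^ k) := by
  let := gs.toLattice
  obtain ⟨b, hb, hbx⟩ := gs.exists_pre_one_and_pre_shift h
  set K : G → G := fun a => gs.wedge (x * a * gs.Δ ^ k) a with hK
  have hdesc (n : ℕ) : gs.pre (K^[n + 1] 1) (K^[n] 1) := by
    rw [Function.iterate_succ_apply']
    exact gs.wedge_le_right _ _
  have hbdd (n : ℕ) : gs.pre b (K^[n] 1) := by
    induction n with
    | zero => exact hb
    | succ n ih =>
      rw [Function.iterate_succ_apply']
      exact gs.le_wedge _ _ _ (hbx.trans ((gs.pre_shift_iff _ _ _ _).mpr ih)) ih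
  obtain ⟨n, hn⟩ := exists_succ_eq_of_descending hdesc hbdd
  refine ⟨n, _, rfl, iterate_inf_le_of_stable (A := fun a => x⁻¹ * a * gs.Δ ^ l)
    (C := fun a => x * a * gs.Δ ^ k) (gs.shift_wedge x⁻¹ l) (gs.shift_wedge x k) ?_ ?_ 1 n hn⟩
  · intro a
    group
  · intro a
    have hmem := gs.zpow_mem hkl
    change gs.pre a (x⁻¹ * (x * a * gs.Δ ^ k) * gs.Δ ^ l)
    unfold pre
    convert hmem using 1
    group

variable {gs}

theorem iterate_sl_eq {x : G} {p q : ℤ}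
    (hx : ∀ n, gs.ginf (gs.sl^[n] x) = p ∧ gs.gsup (gs.sl^[n] x) = q) (n : ℕ) :
    ∃ c, c = (fun a => gs.wedge (gs.wedge (x * a * gs.Δ ^ (-(p + 1)))
        (x⁻¹ * a * gs.Δ ^ (q - 1))) a)^[n] 1 * gs.Δ ^ (n : ℤ) ∧
      gs.sl^[n] x = c⁻¹ * x * c := by
  induction n with
  | zero => exact ⟨1, by simp, by simp⟩
  | succ n ih =>
    refine ⟨_, rfl, ?_⟩
    obtain ⟨c, hc, hxc⟩ := ih
    rw [Function.iterate_succ_apply', Function.iterate_succ_apply']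
    generalize (fun a => gs.wedge (gs.wedge (x * a * gs.Δ ^ (-(p + 1)))
        (x⁻¹ * a * gs.Δ ^ (q - 1))) a)^[n] 1 = e at hc ⊢
    have hpp : c * gs.pp (gs.sl^[n] x) = gs.wedge (gs.wedge (x * e * gs.Δ ^ (-(p + 1)))
        (x⁻¹ * e * gs.Δ ^ (q - 1))) e * gs.Δ ^ ((n + 1 : ℕ) : ℤ) := by
      have hl (a b : G) : c * gs.wedge a b = gs.wedge (c * a) (c * b) := by
        simpa using gs.shift_wedge c 0 a b
      have hr (a b : G) (k : ℤ) :
          gs.wedge a b * gs.Δ ^ k = gs.wedge (a * gs.Δ ^ k) (b * gs.Δ ^ k) := by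
        simpa using gs.shift_wedge 1 k a b
      rw [pp, (hx n).1, (hx n).2, hxc, hl, hl, hr, hr, hc]
      push_cast
      congr 1
      · congr 1 <;> group
      · group
    rw [← hpp, sl]
    nth_rewrite 2 [hxc]
    group

theorem ginf_conj_le_of_iterate_sl (hΔ : gs.Δ ≠ 1) {x : G} {p q : ℤ}
    (hx : ∀ n, gs.ginf (gs.sl^[n] x) = p ∧ gs.gsup (gs.sl^[n] x) = q) (α : G) :
    gs.ginf (α⁻¹ * x * α) ≤ p := by
  by_contra! hlt
  have hα := (le_ginf_iff hΔ).mp (Int.add_one_le_of_lt hlt)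
  rw [zpow_pre_conj_iff, pre_mul_zpow_left_iff] at hα
  have hne (n : ℕ) : ¬ gs.pre (gs.Δ ^ (p + 1)) (gs.sl^[n] x) := by
    rw [← le_ginf_iff hΔ, (hx n).1]
    lia
  rcases le_or_gt q (p + 1) with hpq | hpq
  · have hone := gs.shift_eq_one hα (by
      rw [← pre_mul_zpow_right_iff, one_mul, ← gsup_le_iff hΔ]
      exact (hx 0).2.trans_le hpq)
    rw [zpow_neg, mul_inv_eq_one] at hone
    exact hne 0 (hone ▸ gs.pre_refl _)
  · obtain ⟨n, e, he, hpre⟩ := gs.exists_iterate_pre_shift (l := q - 1) hα (by lia)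
    obtain ⟨c, hc, hxc⟩ := iterate_sl_eq hx n
    apply hne n
    rw [hxc, zpow_pre_conj_iff, hc, he, mul_assoc, ← zpow_add, add_comm, zpow_add, ← mul_assoc,
      ← mul_assoc, pre_mul_zpow_iff, pre_mul_zpow_left_iff]
    exact hpre

theorem le_gsup_conj_of_iterate_sl (hΔ : gs.Δ ≠ 1) {x : G} {p q : ℤ}
    (hx : ∀ n, gs.ginf (gs.sl^[n] x) = p ∧ gs.gsup (gs.sl^[n] x) = q) (α : G) :
    q ≤ gs.gsup (α⁻¹ * x * α) := by
  by_contra! hlt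
  have hα := (gsup_le_iff hΔ).mp (Int.le_sub_one_of_lt hlt)
  rw [conj_pre_zpow_iff, ← pre_mul_inv_right_iff, ← mul_assoc] at hα
  have hne (n : ℕ) : ¬ gs.pre (gs.sl^[n] x) (gs.Δ ^ (q - 1)) := by
    rw [← gsup_le_iff hΔ, (hx n).2]
    lia
  rcases le_or_gt q (p + 1) with hpq | hpq
  · have hone := gs.shift_eq_one hα (by
      rw [pre_mul_inv_left_iff, mul_one, ← le_ginf_iff hΔ]
      exact (show q - 1 ≤ p by lia).trans (hx 0).1.ge)
    rw [inv_mul_eq_one] at hone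
    exact hne 0 (hone ▸ gs.pre_refl _)
  · obtain ⟨n, e, he, hpre⟩ := gs.exists_iterate_pre_shift (l := -(p + 1)) hα (by lia)
    obtain ⟨c, hc, hxc⟩ := iterate_sl_eq hx n
    have hcomm (a b : G) : gs.wedge a b = gs.wedge b a :=
      letI := gs.toLattice
      inf_comm a b
    simp only [inv_inv, hcomm (x⁻¹ * _ * _)] at he
    apply hne n
    rw [hxc, conj_pre_zpow_iff, hc, he, mul_assoc e, ← zpow_add, add_comm (n : ℤ), zpow_add,
      ← mul_assoc, ← mul_assoc, pre_mul_zpow_iff, ← pre_mul_inv_right_iff, ← mul_assoc]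
    exact hpre

theorem conjBounded_one (hΔ : gs.Δ ≠ 1) (x : G) :
    gs.ConjBounded (gs.ginf x) (gs.gsup x) x 1 := by
  simp [conjBounded_iff gs hΔ]

theorem mem_SSS_of_mem_SC (hΔ : gs.Δ ≠ 1) {x z : G} (hz : z ∈ gs.SC x) : z ∈ gs.SSS x := by
  obtain ⟨⟨α, rfl⟩, m, hm, hper⟩ := hz
  set z := α⁻¹ * x * α with hz
  have hsl (y : G) : gs.ginf y ≤ gs.ginf (gs.sl y) ∧ gs.gsup (gs.sl y) ≤ gs.gsup y :=
    (conjBounded_iff gs hΔ _ _ _ _).mp (conjBounded_one hΔ y).pp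
  have hinf : Monotone fun n => gs.ginf (gs.sl^[n] z) := monotone_nat_of_le_succ fun n => by
    simpa only [Function.iterate_succ_apply'] using (hsl _).1
  have hsup : Antitone fun n => gs.gsup (gs.sl^[n] z) := antitone_nat_of_succ_le fun n => by
    simpa only [Function.iterate_succ_apply'] using (hsl _).2
  have hperiod (n : ℕ) : gs.sl^[m * n] z = z :=
    (Function.IsPeriodicPt.mul_const (f := gs.sl) hper n :)
  have hconst (n : ℕ) :
      gs.ginf (gs.sl^[n] z) = gs.ginf z ∧ gs.gsup (gs.sl^[n] z) = gs.gsup z := by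
    have hn : n ≤ m * n := Nat.le_mul_of_pos_left n hm
    refine ⟨le_antisymm ?_ (hinf n.zero_le), le_antisymm (hsup n.zero_le) ?_⟩
    · simpa only [hperiod] using hinf hn
    · simpa only [hperiod] using hsup hn
  refine ⟨⟨α, rfl⟩, ?_⟩
  rintro _ ⟨β, rfl⟩
  have hβ : β⁻¹ * x * β = (α⁻¹ * β)⁻¹ * z * (α⁻¹ * β) := by
    rw [hz]
    group
  rw [hβ]
  exact ⟨ginf_conj_le_of_iterate_sl hΔ hconst _, le_gsup_conj_of_iterate_sl hΔ hconst _⟩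

theorem ginf_eq_of_mem_SSS {x v w : G} (hv : v ∈ gs.SSS x) (hw : w ∈ gs.SSS x) :
    gs.ginf v = gs.ginf w :=
  le_antisymm (hw.2 v hv.1).1 (hv.2 w hw.1).1

theorem gsup_eq_of_mem_SSS {x v w : G} (hv : v ∈ gs.SSS x) (hw : w ∈ gs.SSS x) :
    gs.gsup v = gs.gsup w :=
  le_antisymm (hv.2 w hw.1).2 (hw.2 v hv.1).2

theorem conj_mem_SSS (hΔ : gs.Δ ≠ 1) {x z α : G} (hz : z ∈ gs.SSS x)
    (hα : gs.ConjBounded (gs.ginf z) (gs.gsup z) z α) : α⁻¹ * z * α ∈ gs.SSS x := by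
  obtain ⟨⟨β, rfl⟩, hmax⟩ := hz
  obtain ⟨hinf, hsup⟩ := (conjBounded_iff gs hΔ _ _ _ _).mp hα
  refine ⟨⟨β * α, by group⟩, fun y hy => ?_⟩
  exact ⟨(hmax y hy).1.trans hinf, hsup.trans (hmax y hy).2⟩

variable (gs)

theorem inv_ps (x : G) : (gs.ps x)⁻¹ = gs.vee (gs.vee (x⁻¹ * gs.Δ ^ gs.ginf x)
    (x * gs.Δ ^ (-gs.gsup x))) gs.Δ⁻¹ := by
  simp [ps, rwedge]

theorem inv_ps_pre_mul_inv_pp {v w t : G} (ht : t ∈ gs.P) (hinf : gs.ginf v = gs.ginf w)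
    (hsup : gs.gsup v = gs.gsup w) (h : (gs.pp v)⁻¹ * v * gs.pp v = t⁻¹ * w * t) :
    gs.pre (gs.ps w)⁻¹ (t * (gs.pp v)⁻¹) := by
  have hw : w = t * ((gs.pp v)⁻¹ * v * gs.pp v) * t⁻¹ := by
    rw [h]
    group
  have h₁ : gs.pre (gs.pp v) (v * gs.Δ ^ (-gs.ginf v)) :=
    gs.wedge_pre_of_left (gs.wedge_le_left _ _)
  have h₂ : gs.pre (gs.pp v) (v⁻¹ * gs.Δ ^ gs.gsup v) :=
    gs.wedge_pre_of_left (gs.wedge_le_right _ _)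
  have h₃ : gs.pre (gs.pp v) gs.Δ := gs.wedge_le_right _ _
  rw [inv_ps, ← hinf, ← hsup]
  generalize gs.pp v = g at *
  refine gs.vee_le _ _ _ (gs.vee_le _ _ _ ?_ ?_) ?_
  · convert gs.conj_zpow_mem (gs.ginf v) (gs.mul_mem ht h₁) using 1
    rw [hw]
    group
  · convert gs.conj_zpow_mem (-gs.gsup v) (gs.mul_mem ht h₂) using 1
    rw [hw]
    group
  · convert gs.conj_zpow_mem (-1) (gs.mul_mem ht h₃) using 1
    group

theorem ps_pre_mul_pp {v w c : G} (hc : c ∈ gs.P) (hinf : gs.ginf v = gs.ginf w)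
    (hsup : gs.gsup v = gs.gsup w) (h : v = c⁻¹ * (gs.ps w * w * (gs.ps w)⁻¹) * c) :
    gs.pre (gs.ps w) (c * gs.pp v) := by
  have h₁ : gs.pre (w⁻¹ * gs.Δ ^ gs.ginf w) (gs.ps w)⁻¹ := by
    rw [inv_ps]
    exact gs.pre_vee_of_left (gs.le_vee_left _ _)
  have h₂ : gs.pre (w * gs.Δ ^ (-gs.gsup w)) (gs.ps w)⁻¹ := by
    rw [inv_ps]
    exact gs.pre_vee_of_left (gs.le_vee_right _ _)
  have h₃ : gs.pre gs.Δ⁻¹ (gs.ps w)⁻¹ := by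
    rw [inv_ps]
    exact gs.le_vee_right _ _
  rw [← mul_inv_cancel_left c (gs.ps w), pre_mul_left_iff, pp, hinf, hsup]
  generalize gs.ps w = r at *
  refine gs.le_wedge _ _ _ (gs.le_wedge _ _ _ ?_ ?_) ?_
  · convert gs.conj_zpow_mem (-gs.ginf w) (gs.mul_mem h₁ hc) using 1
    rw [h]
    group
  · convert gs.conj_zpow_mem (gs.gsup w) (gs.mul_mem h₂ hc) using 1
    rw [h]
    group
  · convert gs.conj_zpow_mem 1 (gs.mul_mem h₃ hc) using 1
    group

theorem isPullback_of_Delta_ne_one (hΔ : gs.Δ ≠ 1) {x z s : G} (hz : z ∈ gs.SC x)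
    (hys : s⁻¹ * gs.sl z * s ∈ gs.SSS x) :
    gs.IsPullback x z s (gs.vee (gs.pp z * s * (gs.ps (s⁻¹ * gs.sl z * s))⁻¹) 1) := by
  have hzS := mem_SSS_of_mem_SC hΔ hz
  set w := s⁻¹ * gs.sl z * s with hw
  set u := gs.vee (gs.pp z * s * (gs.ps w)⁻¹) 1 with hu
  have hwz : w = (gs.pp z * s)⁻¹ * z * (gs.pp z * s) := by
    rw [hw, sl]
    group
  have hβ : gs.ConjBounded (gs.ginf z) (gs.gsup z) z (gs.pp z * s * (gs.ps w)⁻¹) := by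
    rw [ginf_eq_of_mem_SSS hzS hys, gsup_eq_of_mem_SSS hzS hys]
    exact (conjBounded_one hΔ w).inv_ps.trans hwz
  have huS : u⁻¹ * z * u ∈ gs.SSS x := conj_mem_SSS hΔ hzS (hβ.vee (conjBounded_one hΔ z))
  refine ⟨(gs.one_pre_iff u).mp (gs.le_vee_right _ _), huS, ?_, fun u' hu' hu'S hsu' => ?_⟩
  · have hpre := gs.ps_pre_mul_pp (gs.le_vee_left (gs.pp z * s * (gs.ps w)⁻¹) 1)
      (ginf_eq_of_mem_SSS huS hys) (gsup_eq_of_mem_SSS huS hys) (by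
        rw [← hu]
        nth_rewrite 3 [hwz]
        group)
    rw [← hu] at hpre
    unfold pre at hpre
    unfold pre transport
    convert hpre using 1
    group
  · refine gs.vee_le _ _ _ ?_ (by simpa using hu')
    have hpre := gs.inv_ps_pre_mul_inv_pp hsu' (ginf_eq_of_mem_SSS hu'S hys)
      (gsup_eq_of_mem_SSS hu'S hys) (by
        rw [hwz, transport]
        group)
    unfold pre transport at hpre
    convert hpre using 1
    group

end GarsideStructure

/-- The pullback of `s` at `y = 𝔰(z)` is `(𝔭(z) · s · 𝔭↰(y^s)⁻¹) ∨ 1`. -/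
theorem pullback_computation (gs : GarsideStructure G) (x z y s : G)
    (hz : z ∈ gs.SC x) (hy : y = gs.sl z) (hs : s ∈ gs.P)
    (hys : s⁻¹ * y * s ∈ gs.SSS x) :
    gs.IsPullback x z s (gs.vee (gs.pp z * s * (gs.ps (s⁻¹ * y * s))⁻¹) 1) := by
  subst hy
  by_cases hΔ : gs.Δ = 1
  · have := gs.subsingleton_of_Delta_eq_one hΔ
    have hP (a : G) : a ∈ gs.P := Subsingleton.elim 1 a ▸ gs.one_mem
    have hSSS (a : G) : a ∈ gs.SSS x := Subsingleton.elim (s⁻¹ * gs.sl z * s) a ▸ hys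
    exact ⟨hP _, hSSS _, hP _, fun _ _ _ _ => hP _⟩
  · exact gs.isPullback_of_Delta_ne_one hΔ hz hys
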